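/- Let d and n be positive integers, α ∈ (0,1), and θ : Fin d → ℝ with θ q > 0 for all q. Let μ = Measure.pi (fun _ : Fin (n+1) => Measure.pi (fun q : Fin d => Unif(−θ q, θ q))) be the law of n+1 i.i.d. d-dimensional samples with independent symmetric-uniform coordinates. Define w̄(w)(q) = max_{i ∈ Fin n} |w i q| over the first n samples and the random hyper-rectangle Ŵ(w) = Set.univ.pi (fun q => Set.Icc (−w̄(w)(q)·(α/d)^{−1/n}) (w̄(w)(q)·(α/d)^{−1/n})). Then the probability that the fresh sample w n falls outside Ŵ(w) satisfies μ({w | ∃ q, w n q ∉ Set.Icc (−w̄(w)(q)·(α/d)^{−1/n}) (w̄(w)(q)·(α/d)^{−1/n})}) ≤ α. -/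

import Mathlib

open MeasureTheory

/-- `unif a b` is the uniform probability measure on the interval `[a, b]`:
`(b - a)⁻¹` times Lebesgue measure restricted to `[a, b]`. -/
noncomputable def unif (a b : ℝ) : Measure ℝ :=
  (ENNReal.ofReal (b - a))⁻¹ • volume.restrict (Set.Icc a b)

lemma isProbabilityMeasure_unif {a b : ℝ} (hab : a < b) : IsProbabilityMeasure (unif a b) := by
  refine ⟨?_⟩
  have hpos : ENNReal.ofReal (b - a) ≠ 0 := by simpa using hab
  simp [unif, ENNReal.inv_mul_cancel hpos ENNReal.ofReal_ne_top]

lemma ae_mem_Icc_unif (a b : ℝ) : ∀ᵐ x ∂unif a b, x ∈ Set.Icc a b :=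
  Measure.ae_smul_measure (ae_restrict_mem measurableSet_Icc) _

lemma unif_Icc_scaled_le {t r : ℝ} (ht : 0 < t) :
    unif (-t) t (Set.Icc (-(t * r)) (t * r)) ≤ ENNReal.ofReal r := by
  have hpos : ENNReal.ofReal (t - -t) ≠ 0 := by simpa using ht
  calc unif (-t) t (Set.Icc (-(t * r)) (t * r))
      ≤ (ENNReal.ofReal (t - -t))⁻¹ * volume (Set.Icc (-(t * r)) (t * r)) := by
        simp only [unif, Measure.smul_apply, smul_eq_mul]
        gcongr
        exact Measure.restrict_le_self
    _ = (ENNReal.ofReal (t - -t))⁻¹ * (ENNReal.ofReal (t - -t) * ENNReal.ofReal r) := by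
        rw [Real.volume_Icc, ← ENNReal.ofReal_mul (by linarith)]
        ring_nf
    _ = ENNReal.ofReal r := by
        rw [← mul_assoc, ENNReal.inv_mul_cancel hpos ENNReal.ofReal_ne_top, one_mul]

/-- If the inflated sample maximum fails to cover a point of `[-t, t]`, then every sample lies in
the shrunken interval `[-t * c⁻¹, t * c⁻¹]`. -/
lemma mem_Icc_of_notMem_Icc_iSup {ι : Type*} [Finite ι] {x : ι → ℝ} {y t c : ℝ} (hc : 0 < c)
    (hy : y ∈ Set.Icc (-t) t)
    (hfail : y ∉ Set.Icc (-((⨆ i, |x i|) * c)) ((⨆ i, |x i|) * c)) (i : ι) :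
    x i ∈ Set.Icc (-(t * c⁻¹)) (t * c⁻¹) := by
  rw [Set.mem_Icc, ← abs_le] at hy hfail ⊢
  have hle : |x i| ≤ ⨆ i, |x i| := le_ciSup (f := fun i => |x i|) (Set.finite_range _).bddAbove i
  rw [← div_eq_mul_inv, le_div_iff₀ hc]
  nlinarith

/-- Failure bound for a single coordinate `q`. -/
lemma pi_unif_coordinate_failure_le {d n : ℕ} (θ : Fin d → ℝ) (hθ : ∀ q, 0 < θ q) {c : ℝ}
    (hc : 0 < c) (q : Fin d) :
    (Measure.pi fun _ : Fin (n + 1) => Measure.pi fun q : Fin d => unif (-θ q) (θ q))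
      {w : Fin (n + 1) → Fin d → ℝ | w (Fin.last n) q ∉
          Set.Icc (-((⨆ i : Fin n, |w i.castSucc q|) * c))
            ((⨆ i : Fin n, |w i.castSucc q|) * c)} ≤
      ENNReal.ofReal (c⁻¹ ^ n) := by
  have (q : Fin d) : IsProbabilityMeasure (unif (-θ q) (θ q)) :=
    isProbabilityMeasure_unif (by linarith [hθ q])
  set ν : Measure (Fin d → ℝ) := Measure.pi fun q : Fin d => unif (-θ q) (θ q)
  set S : Set (Fin d → ℝ) := Function.eval q ⁻¹' Set.Icc (-(θ q * c⁻¹)) (θ q * c⁻¹)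
  have hS : ν S ≤ ENNReal.ofReal c⁻¹ := by
    rw [(measurePreserving_eval _ q).measure_preimage measurableSet_Icc.nullMeasurableSet]
    exact unif_Icc_scaled_le (hθ q)
  have hlast : ∀ᵐ w ∂(Measure.pi fun _ : Fin (n + 1) => ν),
      w (Fin.last n) q ∈ Set.Icc (-θ q) (θ q) :=
    (measurePreserving_eval (fun _ : Fin (n + 1) => ν) (Fin.last n)).quasiMeasurePreserving.ae
      ((measurePreserving_eval (fun q => unif (-θ q) (θ q)) q).quasiMeasurePreserving.ae
        (ae_mem_Icc_unif _ _))
  calc _ ≤ (Measure.pi fun _ : Fin (n + 1) => ν)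
        (Set.univ.pi (Fin.snoc (fun _ : Fin n => S) Set.univ : Fin (n + 1) → Set (Fin d → ℝ))) := by
        refine measure_mono_ae ?_
        filter_upwards [hlast] with w hw hfail j _
        induction j using Fin.lastCases with
        | last => simp
        | cast i => simpa [S] using mem_Icc_of_notMem_Icc_iSup hc hw hfail i
    _ = ν S ^ n := by
        rw [Measure.pi_pi, Fin.prod_univ_castSucc]
        simp
    _ ≤ ENNReal.ofReal (c⁻¹ ^ n) := by
        rw [ENNReal.ofReal_pow (by positivity)]
        gcongr

/-- **Disturbance Support Failure bound (d-dimensional, LRBF uniform case study).**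
Given `n + 1` i.i.d. `d`-dimensional samples with independent `Unif(-θ q, θ q)`
coordinates, let `w̄ q = max_{i < n} |w i q|` over the first `n` samples and
`Ŵ(w) = ∏ q, [-w̄ q · (α/d)^{-1/n}, w̄ q · (α/d)^{-1/n}]`. The probability that the
fresh `(n+1)`-st sample falls outside `Ŵ(w)` is at most `α`. -/
theorem uniform_product_support_failure_bound (d n : ℕ) (hd : 0 < d) (hn : 0 < n)
    (α : ℝ) (hα : α ∈ Set.Ioo (0 : ℝ) 1)
    (θ : Fin d → ℝ) (hθ : ∀ q, 0 < θ q) :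
    (Measure.pi fun _ : Fin (n + 1) => Measure.pi fun q : Fin d => unif (-θ q) (θ q))
      {w : Fin (n + 1) → Fin d → ℝ |
        ∃ q, w (Fin.last n) q ∉
          Set.Icc (-((⨆ i : Fin n, |w i.castSucc q|) * (α / d) ^ (-1 / (n : ℝ))))
            ((⨆ i : Fin n, |w i.castSucc q|) * (α / d) ^ (-1 / (n : ℝ)))} ≤
      ENNReal.ofReal α := by
  obtain ⟨hα0, -⟩ := hα
  have hd' : (0 : ℝ) < d := by exact_mod_cast hd
  have hβ : 0 < α / d := by positivity
  have hpow : (((α / d) ^ (-1 / (n : ℝ)))⁻¹) ^ n = α / d := by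
    rw [← Real.rpow_neg hβ.le, neg_div, neg_neg, one_div, Real.rpow_inv_natCast_pow hβ.le hn.ne']
  rw [Set.ofPred_exists]
  calc _ ≤ ∑ _q : Fin d, ENNReal.ofReal (α / d) := by
        refine (measure_iUnion_fintype_le _ _).trans (Finset.sum_le_sum fun q _ => ?_)
        exact (pi_unif_coordinate_failure_le θ hθ (Real.rpow_pos_of_pos hβ _) q).trans_eq
          (congrArg ENNReal.ofReal hpow)
    _ = ENNReal.ofReal α := by
        rw [← ENNReal.ofReal_sum_of_nonneg fun _ _ => hβ.le]
        congr 1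
        simp
        field_simp
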